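/- arXiv:2302.06585 — 2 statements merged into one kernel-verified Lean document; each statement's English description precedes it below -/
import Mathlib

section
/- Let n = 3 and let ω be the 3×3 identity matrix (Euclidean metric). For every smooth map Ω : ℝ³ → Sym(3,ℝ) and all indices i,j, the linearized Einstein operator satisfies E(Ω)_{ij} = −(1/2) Σ_{k,l,m,p} ε_{ikl} ε_{jmp} ∂_k∂_m Ω_{lp}, where ε is the Levi-Civita symbol on three indices. In other words, in dimension 3 the linearized Einstein operator coincides, up to the factor −1/2, with the Beltrami operator ε_{ikl} ε_{jmp} ∂_k∂_m introduced by Beltrami in 1892 to parametrize the Cauchy stress equations. -/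
/-- Partial derivative in the `i`-th coordinate direction of `ℝⁿ = Fin n → ℝ`. -/
noncomputable def pd {n : ℕ} (i : Fin n) (f : (Fin n → ℝ) → ℝ) : (Fin n → ℝ) → ℝ :=
  fun x => fderiv ℝ f x (Pi.single i 1)

/-- Second partial derivative `∂_i ∂_j`. -/
noncomputable def pd2 {n : ℕ} (i j : Fin n) (f : (Fin n → ℝ) → ℝ) : (Fin n → ℝ) → ℝ :=
  pd i (pd j f)

/-- The linearized Einstein operator over a constant metric `ω` with inverse `ωinv`. -/
noncomputable def einsteinOp {n : ℕ} (ω ωinv : Matrix (Fin n) (Fin n) ℝ)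
    (Ω : (Fin n → ℝ) → Fin n → Fin n → ℝ) (i j : Fin n) : (Fin n → ℝ) → ℝ :=
  fun x =>
    (1 / 2) * ((∑ r, ∑ s, ωinv r s * pd2 r s (fun y => Ω y i j) x)
      + pd2 i j (fun y => ∑ r, ∑ s, ωinv r s * Ω y r s) x
      - (∑ r, ∑ s, ωinv r s * (pd2 r i (fun y => Ω y s j) x + pd2 r j (fun y => Ω y s i) x))
      - ω i j * ((∑ r, ∑ s, ωinv r s * pd2 r s (fun y => ∑ u, ∑ v, ωinv u v * Ω y u v) x)
        - ∑ r, ∑ u, ∑ s, ∑ v, ωinv r u * ωinv s v * pd2 r s (fun y => Ω y u v) x))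

/-- The Levi-Civita symbol on three indices. -/
noncomputable def lc (i j k : Fin 3) : ℝ :=
  (((j : ℕ) : ℝ) - ((i : ℕ) : ℝ)) * (((k : ℕ) : ℝ) - ((i : ℕ) : ℝ))
    * (((k : ℕ) : ℝ) - ((j : ℕ) : ℝ)) / 2

theorem pd_sum {n : ℕ} {ι : Type*} (s : Finset ι) (i : Fin n) {f : ι → (Fin n → ℝ) → ℝ}
    (hf : ∀ a ∈ s, Differentiable ℝ (f a)) :
    pd i (fun y => ∑ a ∈ s, f a y) = fun y => ∑ a ∈ s, pd i (f a) y := by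
  funext x
  simp only [pd]
  rw [fderiv_fun_sum fun a ha => hf a ha x]
  simp

theorem contDiff_pd {n : ℕ} (i : Fin n) {f : (Fin n → ℝ) → ℝ} (hf : ContDiff ℝ (⊤ : ℕ∞) f) :
    ContDiff ℝ (⊤ : ℕ∞) (pd i f) :=
  (hf.fderiv_right (by simp)).clm_apply contDiff_const

theorem pd2_sum {n : ℕ} {ι : Type*} (s : Finset ι) (i j : Fin n) {f : ι → (Fin n → ℝ) → ℝ}
    (hf : ∀ a ∈ s, ContDiff ℝ (⊤ : ℕ∞) (f a)) (x : Fin n → ℝ) :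
    pd2 i j (fun y => ∑ a ∈ s, f a y) x = ∑ a ∈ s, pd2 i j (f a) x := by
  simp only [pd2]
  rw [pd_sum s j fun a ha => (hf a ha).differentiable (by simp),
    pd_sum s i fun a ha => (contDiff_pd j (hf a ha)).differentiable (by simp)]

theorem pd2_comm {n : ℕ} (i j : Fin n) {f : (Fin n → ℝ) → ℝ} (hf : ContDiff ℝ (⊤ : ℕ∞) f)
    (x : Fin n → ℝ) : pd2 i j f x = pd2 j i f x := by
  have h (k l : Fin n) : pd2 k l f x
      = fderiv ℝ (fderiv ℝ f) x (Pi.single k 1) (Pi.single l 1) := by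
    have hd : DifferentiableAt ℝ (fderiv ℝ f) x :=
      (hf.fderiv_right (m := (⊤ : ℕ∞)) (by simp)).differentiable (by simp) x
    change fderiv ℝ (fun y => fderiv ℝ f y (Pi.single l 1)) x (Pi.single k 1) = _
    rw [fderiv_clm_apply hd (differentiableAt_const _)]
    simp
  rw [h, h]
  exact (hf.contDiffAt.isSymmSndFDerivAt (by simpa using WithTop.coe_le_coe.2 (le_top : (2 : ℕ∞) ≤ ⊤))) _ _

/-- Contraction of two Levi-Civita symbols against an array with the symmetries of
`∂_k∂_m Ω_{lp}`. -/
theorem sum_lc_mul_lc (D : Fin 3 → Fin 3 → Fin 3 → Fin 3 → ℝ)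
    (hD : ∀ k m l p, D k m l p = D m k l p) (hD' : ∀ k m l p, D k m l p = D k m p l)
    (i j : Fin 3) :
    ∑ k, ∑ l, ∑ m, ∑ p, lc i k l * lc j m p * D k m l p
      = (1 : Matrix (Fin 3) (Fin 3) ℝ) i j
          * (∑ r, ∑ u, D r r u u - ∑ r, ∑ s, D r s r s)
        - ∑ u, D i j u u + ∑ r, (D r i r j + D r j r i) - ∑ r, D r r i j := by
  have h₁ (l p) := hD 1 0 l p
  have h₂ (l p) := hD 2 0 l p
  have h₃ (l p) := hD 2 1 l p
  have h₄ (k m) := hD' k m 1 0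
  have h₅ (k m) := hD' k m 2 0
  have h₆ (k m) := hD' k m 2 1
  fin_cases i <;> fin_cases j <;>
    simp [Fin.sum_univ_three, lc, h₁, h₂, h₃, h₄, h₅, h₆] <;> ring

/-- In dimension 3 over the Euclidean metric, the linearized Einstein operator coincides,
up to the factor `−1/2`, with the Beltrami operator `ε_{ikl} ε_{jmp} ∂_k∂_m`. -/
theorem einstein_eq_beltrami_dim3
    (Ω : (Fin 3 → ℝ) → Fin 3 → Fin 3 → ℝ)
    (hsmooth : ∀ i j, ContDiff ℝ (⊤ : ℕ∞) fun x => Ω x i j)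
    (hsym : ∀ x i j, Ω x i j = Ω x j i)
    (i j : Fin 3) (x : Fin 3 → ℝ) :
    einsteinOp (1 : Matrix (Fin 3) (Fin 3) ℝ) (1 : Matrix (Fin 3) (Fin 3) ℝ) Ω i j x
      = -(1 / 2) * ∑ k, ∑ l, ∑ m, ∑ p,
          lc i k l * lc j m p * pd2 k m (fun y => Ω y l p) x := by
  have htr (k m : Fin 3) : pd2 k m (fun y => ∑ u, Ω y u u) x
      = ∑ u, pd2 k m (fun y => Ω y u u) x :=
    pd2_sum _ k m (fun u _ => hsmooth u u) x
  rw [sum_lc_mul_lc (fun k m l p => pd2 k m (fun y => Ω y l p) x)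
    (fun k m l p => pd2_comm k m (hsmooth l p) x)
    (fun k m l p => by simp only [hsym _ l p]) i j]
  simp only [einsteinOp, Matrix.one_apply, ite_mul, mul_ite, one_mul, mul_one, zero_mul,
    mul_zero, Finset.sum_ite_irrel, Finset.sum_const_zero, Finset.sum_ite_eq,
    Finset.mem_univ, if_true, htr]
  ring
end

section
/- (First order parametrization of the Cosserat couple-stress equations.) Let σ^{11}, σ^{12}, σ^{21}, σ^{22}, μ^{12,1}, μ^{12,2} : ℝ² → ℝ be smooth functions satisfying the Cosserat equations ∂_1 σ^{11} + ∂_2 σ^{12} = 0, ∂_1 σ^{21} + ∂_2 σ^{22} = 0, and ∂_1 μ^{12,1} + ∂_2 μ^{12,2} + σ^{12} − σ^{21} = 0 on ℝ². Then there exist smooth potentials φ^1, φ^2, φ^3 : ℝ² → ℝ such that σ^{11} = ∂_2 φ^1, σ^{12} = −∂_1 φ^1, σ^{21} = −∂_2 φ^2, σ^{22} = ∂_1 φ^2, μ^{12,1} = ∂_2 φ^3 + φ^1, and μ^{12,2} = −∂_1 φ^3 − φ^2. -/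
open scoped ContDiff

theorem fderiv_apply_eq_pd {f : (Fin 2 → ℝ) → ℝ} (x v : Fin 2 → ℝ) :
    fderiv ℝ f x v = v 0 * pd 0 f x + v 1 * pd 1 f x := by
  have hv : v = v 0 • Pi.single 0 1 + v 1 • Pi.single 1 1 := by
    ext i
    fin_cases i <;> simp
  conv_lhs => rw [hv]
  simp only [map_add, map_smul, smul_eq_mul, pd]

theorem pd_sub {n : ℕ} {i : Fin n} {f g : (Fin n → ℝ) → ℝ} {x : Fin n → ℝ}
    (hf : DifferentiableAt ℝ f x) (hg : DifferentiableAt ℝ g x) :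
    pd i (fun y => f y - g y) x = pd i f x - pd i g x := by
  simp only [pd, fderiv_fun_sub hf hg, sub_apply]

theorem pd_neg {n : ℕ} {i : Fin n} {f : (Fin n → ℝ) → ℝ} {x : Fin n → ℝ} :
    pd i (fun y => -f y) x = -pd i f x := by
  simp only [pd, fderiv_fun_neg, neg_apply]

/-- Poincaré lemma on `ℝ²`: a smooth closed `1`-form `f dx₁ + g dx₂` has a smooth primitive. -/
theorem exists_contDiff_pd_eq {f g : (Fin 2 → ℝ) → ℝ} (hf : ContDiff ℝ ∞ f)
    (hg : ContDiff ℝ ∞ g) (hfg : ∀ x, pd 1 f x = pd 0 g x) :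
    ∃ φ : (Fin 2 → ℝ) → ℝ, ContDiff ℝ ∞ φ ∧ (∀ x, pd 0 φ x = f x) ∧ ∀ x, pd 1 φ x = g x := by
  let p : Fin 2 → (Fin 2 → ℝ) →L[ℝ] ℝ := fun i => ContinuousLinearMap.proj i
  let α : (Fin 2 → ℝ) → (Fin 2 → ℝ) →L[ℝ] ℝ := fun x => f x • p 0 + g x • p 1
  have hα : ContDiff ℝ ∞ α := (hf.smul contDiff_const).add (hg.smul contDiff_const)
  have hdf : Differentiable ℝ f := hf.differentiable (by simp)
  have hdg : Differentiable ℝ g := hg.differentiable (by simp)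
  have hdα (a v w : Fin 2 → ℝ) :
      fderiv ℝ α a v w = fderiv ℝ f a v * w 0 + fderiv ℝ g a v * w 1 := by
    have h : HasFDerivAt α ((fderiv ℝ f a).smulRight (p 0) + (fderiv ℝ g a).smulRight (p 1)) a :=
      ((hdf a).hasFDerivAt.smul_const (p 0)).add ((hdg a).hasFDerivAt.smul_const (p 1))
    rw [h.fderiv]
    simp [p]
  obtain ⟨φ, hφ⟩ := convex_univ.exists_forall_hasFDerivAt_of_fderiv_symmetric isOpen_univ
    (hα.differentiable (by simp)).differentiableOn (fun a _ v w => by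
      simp only [hdα, fderiv_apply_eq_pd, hfg]
      ring)
  have hφα : fderiv ℝ φ = α := funext fun x => (hφ x trivial).fderiv
  refine ⟨φ, contDiff_infty_iff_fderiv.2 ⟨fun x => (hφ x trivial).differentiableAt, hφα ▸ hα⟩,
    fun x => ?_, fun x => ?_⟩ <;> simp [pd, hφα, α, p]

/-- First order parametrization of the Cosserat couple-stress equations on `ℝ²`:
every smooth solution `(σ, μ)` of `∂_1σ¹¹+∂_2σ¹² = 0`, `∂_1σ²¹+∂_2σ²² = 0`,
`∂_1μ^{12,1}+∂_2μ^{12,2}+σ¹²−σ²¹ = 0` derives from three smooth potentials. -/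
theorem cosserat_parametrization
    (σ11 σ12 σ21 σ22 μ1 μ2 : (Fin 2 → ℝ) → ℝ)
    (h11 : ContDiff ℝ (⊤ : ℕ∞) σ11) (h12 : ContDiff ℝ (⊤ : ℕ∞) σ12)
    (h21 : ContDiff ℝ (⊤ : ℕ∞) σ21) (h22 : ContDiff ℝ (⊤ : ℕ∞) σ22)
    (hm1 : ContDiff ℝ (⊤ : ℕ∞) μ1) (hm2 : ContDiff ℝ (⊤ : ℕ∞) μ2)
    (heq1 : ∀ x, pd 0 σ11 x + pd 1 σ12 x = 0)
    (heq2 : ∀ x, pd 0 σ21 x + pd 1 σ22 x = 0)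
    (heq3 : ∀ x, pd 0 μ1 x + pd 1 μ2 x + σ12 x - σ21 x = 0) :
    ∃ φ1 φ2 φ3 : (Fin 2 → ℝ) → ℝ,
      ContDiff ℝ (⊤ : ℕ∞) φ1 ∧ ContDiff ℝ (⊤ : ℕ∞) φ2 ∧ ContDiff ℝ (⊤ : ℕ∞) φ3 ∧
      (∀ x, σ11 x = pd 1 φ1 x) ∧ (∀ x, σ12 x = -pd 0 φ1 x) ∧
      (∀ x, σ21 x = -pd 1 φ2 x) ∧ (∀ x, σ22 x = pd 0 φ2 x) ∧
      (∀ x, μ1 x = pd 1 φ3 x + φ1 x) ∧ (∀ x, μ2 x = -pd 0 φ3 x - φ2 x) := by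
  have diff {f : (Fin 2 → ℝ) → ℝ} (hf : ContDiff ℝ ∞ f) (x) : DifferentiableAt ℝ f x :=
    hf.differentiable (by simp) x
  obtain ⟨φ1, hφ1, hφ10, hφ11⟩ := exists_contDiff_pd_eq h12.neg h11 fun x => by
    rw [pd_neg]
    linarith [heq1 x]
  obtain ⟨φ2, hφ2, hφ20, hφ21⟩ := exists_contDiff_pd_eq h22 h21.neg fun x => by
    rw [pd_neg]
    linarith [heq2 x]
  obtain ⟨φ3, hφ3, hφ30, hφ31⟩ :=
    exists_contDiff_pd_eq (hm2.neg.sub hφ2) (hm1.sub hφ1) fun x => by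
      rw [pd_sub (diff hm2.neg x) (diff hφ2 x), pd_neg, pd_sub (diff hm1 x) (diff hφ1 x),
        hφ21, hφ10]
      linarith [heq3 x]
  refine ⟨φ1, φ2, φ3, hφ1, hφ2, hφ3, fun x => ?_, fun x => ?_, fun x => ?_, fun x => ?_,
    fun x => ?_, fun x => ?_⟩
  · rw [hφ11]
  · rw [hφ10, neg_neg]
  · rw [hφ21, neg_neg]
  · rw [hφ20]
  · rw [hφ31, sub_add_cancel]
  · rw [hφ30]
    ring
end
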